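/- arXiv:2008.00663 — 7 statements merged into one kernel-verified Lean document; each statement's English description precedes it below -/
import Mathlib

section
/- Let m ≥ 3 be an odd integer, let q = 2^m, and let F = GF(q). Let f : F → F be an oval polynomial such that f(x^2) = f(x)^2 for all x ∈ F (i.e., f is induced by a polynomial with coefficients in the prime subfield GF(2)). Then the equation f(x) + x + 1 = 0 has no solution in F; that is, f(x) ≠ x + 1 for every x ∈ F. -/
/-- On the line `y = x + 1`, any point of the graph of an oval polynomial determines
every other point. -/
theorem eq_of_oval_of_eq_add_one {F : Type*} [Field F] [Fintype F] (h2 : (2 : F) = 0)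
    {f : F → F} {a y z : F}
    (hinj : Function.Injective fun x : F => (f (x + a) + f a) * x ^ (Fintype.card F - 2))
    (ha : f a = a + 1) (hy : f y = y + 1) (hz : f z = z + 1) (hya : y ≠ a) (hza : z ≠ a) :
    y = z := by
  have slope_eq_one (w : F) (hw : f w = w + 1) (hwa : w ≠ a) :
      (f ((w - a) + a) + f a) * (w - a) ^ (Fintype.card F - 2) = 1 := by
    have hc : Fintype.card F - 2 + 1 = Fintype.card F - 1 := by
      have := Fintype.one_lt_card (α := F)
      omega
    have hsum : f ((w - a) + a) + f a = w - a := by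
      rw [sub_add_cancel, hw, ha]
      linear_combination (a + 1) * h2
    rw [hsum, ← pow_succ', hc]
    exact FiniteField.pow_card_sub_one_eq_one _ (sub_ne_zero.mpr hwa)
  exact sub_left_injective (hinj ((slope_eq_one y hy hya).trans (slope_eq_one z hz hza).symm))

theorem pow_four_pow_eq_self {M : Type*} [Monoid M] {x : M} (hx : x ^ 4 = x) (k : ℕ) :
    x ^ 4 ^ k = x := by
  induction k with
  | zero => simp
  | succ k ih => rw [pow_succ, pow_mul, ih, hx]


/-- **Theorem (no solution of f(x)+x+1=0).**
If `m ≥ 3` is odd, `F = GF(2^m)` and `f` is an oval polynomial over `F` with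
`f(x^2) = f(x)^2` for all `x` (i.e. `f` is induced by a polynomial with
coefficients in `GF(2)`), then the equation `f(x) + x + 1 = 0` has no solution
in `F`, i.e. `f x ≠ x + 1` for every `x ∈ F`. -/
theorem stmt_0 (m : ℕ) (hm : 3 ≤ m) (hmodd : Odd m)
    (F : Type) [Field F] [Fintype F] (hcard : Fintype.card F = 2 ^ m)
    (f : F → F)
    (hbij : Function.Bijective f) (hf0 : f 0 = 0) (hf1 : f 1 = 1)
    (hoval : ∀ a : F, Function.Bijective fun x : F => (f (x + a) + f a) * x ^ (2 ^ m - 2))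
    (hfrob : ∀ x : F, f (x ^ 2) = f x ^ 2) :
    ∀ x : F, f x ≠ x + 1 := by
  intro x hx
  have h2 : (2 : F) = 0 := by
    have h := FiniteField.cast_card_eq_zero F
    rw [hcard] at h
    push_cast at h
    exact pow_eq_zero_iff (by omega) |>.mp h
  have sq_solution (w : F) (hw : f w = w + 1) : f (w ^ 2) = w ^ 2 + 1 := by
    rw [hfrob, hw]
    linear_combination w * h2
  have hx2 := sq_solution x hx
  have hx4 := sq_solution _ hx2
  have hx0 : x ≠ 0 := by
    rintro rfl
    simp [hf0] at hx
  have hx1 : x ≠ 1 := by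
    rintro rfl
    rw [hf1] at hx
    simp at hx
  have sq_ne : x ^ 2 ≠ x := by
    intro h
    have : x * (x - 1) = 0 := by linear_combination h
    rcases mul_eq_zero.mp this with h | h
    · exact hx0 h
    · exact hx1 (sub_eq_zero.mp h)
  have sq_sq_ne : (x ^ 2) ^ 2 ≠ x ^ 2 := by
    intro h
    have : (x ^ 2 - x) ^ 2 = 0 := by linear_combination h + (x ^ 2 - x ^ 3) * h2
    exact sq_ne (sub_eq_zero.mp (pow_eq_zero_iff two_ne_zero |>.mp this))
  have hinj := (hoval (x ^ 2)).injective
  rw [← hcard] at hinj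
  have h4 : x ^ 4 = x := by
    have h := eq_of_oval_of_eq_add_one h2 hinj hx2 hx hx4 sq_ne.symm sq_sq_ne
    linear_combination -h
  obtain ⟨k, rfl⟩ := hmodd
  have hpow := FiniteField.pow_card x
  rw [hcard, pow_succ, pow_mul, pow_mul 2 2 k] at hpow
  norm_num only at hpow
  rw [pow_four_pow_eq_self h4] at hpow
  exact sq_ne hpow
end

section
/- Let m ≥ 2, q = 2^m, F = GF(q), and let f : F → F satisfy f(0) = 0 and f(1) = 1. Then f is an oval polynomial if and only if for every u ∈ F with u ≠ 0 the map f_u : F → F defined by f_u(x) = f(x) + u·x is 2-to-1, i.e., every element of F has either exactly 0 or exactly 2 preimages under f_u. -/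
/-- In a field with `q` elements, the power `x ^ (q - 2)` is the inverse of `x`. -/
lemma FiniteField.pow_card_sub_two {F : Type*} [Field F] [Fintype F]
    (hF : 2 < Fintype.card F) (x : F) : x ^ (Fintype.card F - 2) = x⁻¹ := by
  rcases eq_or_ne x 0 with rfl | hx
  · rw [inv_zero, zero_pow (by omega)]
  · refine eq_inv_of_mul_eq_one_left ?_
    rw [← pow_succ, show Fintype.card F - 2 + 1 = Fintype.card F - 1 by omega]
    exact FiniteField.pow_card_sub_one_eq_one x hx

/-- In characteristic two, the slope of the chord of `f` from `a` to `a + y` is the nonzero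
value `u` exactly when `a + y` is a point other than `a` in the fibre of `x ↦ f x + u * x`
through `a`. -/
lemma slope_eq_iff_of_charTwo {F : Type*} [Field F] [CharP F 2] (f : F → F) {u : F}
    (hu : u ≠ 0) (a y : F) :
    (f (y + a) + f a) * y⁻¹ = u ↔ y ≠ 0 ∧ f (y + a) + u * (y + a) = f a + u * a := by
  have h2 : (2 : F) = 0 := CharTwo.two_eq_zero
  rcases eq_or_ne y 0 with rfl | hy
  · simp [hu.symm]
  · rw [← div_eq_mul_inv, div_eq_iff hy]
    constructor
    · intro h
      exact ⟨hy, by linear_combination h + (u * y - f a) * h2⟩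
    · rintro ⟨-, h⟩
      linear_combination h + (f a - u * y) * h2

/-- **Theorem (2-to-1 characterisation of oval polynomials).**
Let `m ≥ 2`, `q = 2^m`, `F = GF(q)` and let `f : F → F` satisfy `f 0 = 0` and
`f 1 = 1`.  Then `f` is an oval polynomial (i.e. `f` is a bijection and for
every `a` the map `x ↦ (f(x+a)+f(a))·x^(q-2)` is a bijection) if and only if
for every `u ≠ 0` the map `x ↦ f x + u·x` is 2-to-1, i.e. every element of `F`
has exactly 0 or exactly 2 preimages. -/
theorem stmt_2 (m : ℕ) (hm : 2 ≤ m)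
    (F : Type) [Field F] [Fintype F] (hcard : Fintype.card F = 2 ^ m)
    (f : F → F) (hf0 : f 0 = 0) (hf1 : f 1 = 1) :
    (Function.Bijective f ∧
      ∀ a : F, Function.Bijective fun x : F => (f (x + a) + f a) * x ^ (2 ^ m - 2))
    ↔ (∀ u : F, u ≠ 0 → ∀ c : F,
        Nat.card {x : F // f x + u * x = c} = 0 ∨
        Nat.card {x : F // f x + u * x = c} = 2) := by
  have hq : 2 < Fintype.card F := by
    rw [hcard]
    calc 2 < 2 ^ 2 := by norm_num
      _ ≤ 2 ^ m := Nat.pow_le_pow_right (by norm_num) hm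
  have : Fact (Nat.Prime 2) := ⟨Nat.prime_two⟩
  have : CharP F 2 := charP_of_card_eq_prime_pow hcard
  simp only [← hcard, FiniteField.pow_card_sub_two hq]
  constructor
  · rintro ⟨-, hg⟩ u hu c
    rcases isEmpty_or_nonempty {x : F // f x + u * x = c} with _ | ⟨⟨a, rfl⟩⟩
    · exact Or.inl Nat.card_of_isEmpty
    · right
      obtain ⟨y, hy, hyu⟩ := (hg a).existsUnique u
      obtain ⟨hy0, hyc⟩ := (slope_eq_iff_of_charTwo f hu a y).1 hy
      refine (Nat.card_eq_two_iff' ⟨a, rfl⟩).2 ⟨⟨y + a, hyc⟩, by simpa using hy0, ?_⟩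
      rintro ⟨z, hz⟩ hza
      have hza' : z ≠ a := fun h => hza (Subtype.ext h)
      have hzy : z - a = y := hyu (z - a) <|
        (slope_eq_iff_of_charTwo f hu a (z - a)).2 ⟨sub_ne_zero.2 hza', by simpa using hz⟩
      exact Subtype.ext (sub_eq_iff_eq_add.1 hzy)
  · intro h
    have hg (a : F) : Function.Bijective fun x : F => (f (x + a) + f a) * x⁻¹ := by
      refine Finite.surjective_iff_bijective.1 fun u => ?_
      rcases eq_or_ne u 0 with rfl | hu
      · exact ⟨0, by simp⟩
      · have hcard_fibre : Nat.card {x : F // f x + u * x = f a + u * a} = 2 :=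
          (h u hu (f a + u * a)).resolve_left
            (Nat.card_ne_zero.2 ⟨⟨⟨a, rfl⟩⟩, inferInstance⟩)
        obtain ⟨⟨z, hz⟩, hza, -⟩ := (Nat.card_eq_two_iff' ⟨a, rfl⟩).1 hcard_fibre
        have hza' : z ≠ a := fun h => hza (Subtype.ext h)
        exact ⟨z - a, (slope_eq_iff_of_charTwo f hu a (z - a)).2
          ⟨sub_ne_zero.2 hza', by simpa using hz⟩⟩
    refine ⟨Finite.injective_iff_bijective.1 fun x a hxa => ?_, hg⟩
    have hx0 : x - a = 0 := (hg a).1 (by simp [hxa, CharTwo.add_self_eq_zero])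
    exact sub_eq_zero.1 hx0
end

section
/- Let m ≥ 2, q = 2^m, F = GF(q), and let f : F → F be an oval polynomial. Then the code E_f is an MDS code over F with parameters [q+2, 3, q]: it has q^3 codewords (the map (a,b,c) ↦ codeword is injective, so the dimension is 3), every nonzero codeword has Hamming weight q or q+2, the number of codewords of Hamming weight q is (q+2)(q^2-1)/2, and the number of codewords of Hamming weight q+2 is q(q-1)^2/2. -/
/-- The Hamming weight of a vector: the number of nonzero coordinates. -/
def wt {ι F : Type} [Fintype ι] [DecidableEq F] [Zero F] (v : ι → F) : ℕ :=
  (Finset.univ.filter fun i => v i ≠ 0).card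

/-- The codeword of the code `E_f` of length `q+2` associated to `(a,b,c) ∈ F³`:
the vector `((a·f(x)+b·x+c)_{x ∈ F}, a, b)`. -/
def Eword {F : Type} [Field F] (f : F → F) (p : F × F × F) : F ⊕ Fin 2 → F :=
  Sum.elim (fun x => p.1 * f x + p.2.1 * x + p.2.2) ![p.1, p.2.1]

open Finset

theorem Eword_injective {F : Type} [Field F] (f : F → F) : Function.Injective (Eword f) := by
  rintro ⟨a, b, c⟩ ⟨a', b', c'⟩ h
  have h1 : a = a' := by simpa [Eword] using congrFun h (Sum.inr 0)
  have h2 : b = b' := by simpa [Eword] using congrFun h (Sum.inr 1)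
  subst h1 h2
  simpa [Eword] using congrFun h (Sum.inl 0)

theorem Eword_zero {F : Type} [Field F] (f : F → F) : Eword f 0 = 0 := by
  ext i
  rcases i with x | i
  · simp [Eword]
  · fin_cases i <;> simp [Eword]

section

variable {F : Type} [Field F] [Fintype F] [DecidableEq F] (f : F → F)

/-- The zero coordinates of the codeword attached to `p`. -/
def zeroCoords (p : F × F × F) : Finset (F ⊕ Fin 2) :=
  univ.filter fun i => Eword f p i = 0

theorem card_zeroCoords_add_wt (p : F × F × F) :
    (zeroCoords f p).card + wt (Eword f p) = Fintype.card F + 2 := by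
  have := card_filter_add_card_filter_not (s := (univ : Finset (F ⊕ Fin 2)))
    (fun i => Eword f p i = 0)
  simpa [zeroCoords, wt] using this

theorem card_zeroCoords_eq (p : F × F × F) :
    (zeroCoords f p).card =
      (univ.filter fun x : F => p.1 * f x + p.2.1 * x + p.2.2 = 0).card +
        ((if p.1 = 0 then 1 else 0) + if p.2.1 = 0 then 1 else 0) := by
  simp only [zeroCoords, card_filter, Fintype.sum_sum_type, Fin.sum_univ_two]
  simp only [Eword, Sum.elim_inl, Sum.elim_inr, Matrix.cons_val_zero, Matrix.cons_val_one]
  rfl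

theorem card_filter_Eword_apply_eq_zero (i : F ⊕ Fin 2) :
    (univ.filter fun p : F × F × F => Eword f p i = 0).card = Fintype.card F ^ 2 := by
  have key : ∀ g : F × F → F × F × F, Function.Injective g →
      (∀ p, Eword f p i = 0 ↔ ∃ u, g u = p) →
      (univ.filter fun p : F × F × F => Eword f p i = 0).card = Fintype.card F ^ 2 := by
    intro g hg h
    have : (univ.filter fun p : F × F × F => Eword f p i = 0) = univ.image g := by
      ext p
      simp only [mem_filter, mem_univ, true_and, mem_image, h]
    rw [this, card_image_of_injective _ hg, card_univ, Fintype.card_prod, sq]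
  rcases i with x | i
  · refine key (fun u => (u.1, u.2, -(u.1 * f x + u.2 * x))) ?_ ?_
    · rintro ⟨a, b⟩ ⟨a', b'⟩ h
      simp_all
    · rintro ⟨a, b, c⟩
      simp only [Eword, Sum.elim_inl, Prod.exists, Prod.mk.injEq]
      constructor
      · intro h
        exact ⟨a, b, rfl, rfl, by linear_combination -h⟩
      · rintro ⟨_, _, rfl, rfl, rfl⟩
        ring
  · fin_cases i
    · refine key (fun u => (0, u.1, u.2)) ?_ ?_
      · rintro ⟨a, b⟩ ⟨a', b'⟩ h
        simp_all
      · rintro ⟨a, b, c⟩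
        simp [Eword, eq_comm]
    · refine key (fun u => (u.1, 0, u.2)) ?_ ?_
      · rintro ⟨a, b⟩ ⟨a', b'⟩ h
        simp_all
      · rintro ⟨a, b, c⟩
        simp [Eword, eq_comm]

theorem sum_card_zeroCoords :
    ∑ p : F × F × F, (zeroCoords f p).card = (Fintype.card F + 2) * Fintype.card F ^ 2 := by
  simp only [zeroCoords, card_filter]
  rw [sum_comm]
  simp only [← card_filter, card_filter_Eword_apply_eq_zero]
  simp

theorem card_oval_line_eq_zero_or_two [CharP F 2] (hq : 2 < Fintype.card F)
    (hoval : ∀ a : F,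
      Function.Bijective fun x : F => (f (x + a) + f a) * x ^ (Fintype.card F - 2))
    {a b : F} (ha : a ≠ 0) (hb : b ≠ 0) (c : F) :
    (univ.filter fun x : F => a * f x + b * x + c = 0).card = 0 ∨
      (univ.filter fun x : F => a * f x + b * x + c = 0).card = 2 := by
  rcases (univ.filter fun x : F => a * f x + b * x + c = 0).eq_empty_or_nonempty with h | ⟨x, hx⟩
  · simp [h]
  right
  simp only [mem_filter, mem_univ, true_and] at hx
  obtain ⟨y, hy, hyu⟩ := (hoval x).existsUnique (b / a)
  have hpow : ∀ z : F, z ≠ 0 → z * z ^ (Fintype.card F - 2) = 1 := by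
    intro z hz
    rw [← pow_succ', show Fintype.card F - 2 + 1 = Fintype.card F - 1 by omega]
    exact FiniteField.pow_card_sub_one_eq_one z hz
  have hchord : ∀ z : F, z ≠ 0 →
      ((f (z + x) + f x) * z ^ (Fintype.card F - 2) = b / a ↔
        a * f (z + x) + b * (z + x) + c = 0) := by
    intro z hz
    have h2 : (2 : F) = 0 := CharTwo.two_eq_zero
    have hp := hpow z hz
    rw [eq_div_iff ha]
    constructor
    · intro h
      linear_combination z * h - a * (f (z + x) + f x) * hp + hx - (a * f x - b * z) * h2
    · intro h
      linear_combination z ^ (Fintype.card F - 2) * (h + hx) - b * hp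
        - z ^ (Fintype.card F - 2) * (b * x + c) * h2 - b * h2
  have hy0 : y ≠ 0 := by
    rintro rfl
    have : b / a = 0 := by
      rw [← hy]
      simp [zero_pow (show Fintype.card F - 2 ≠ 0 by omega)]
    exact div_ne_zero hb ha this
  have : (univ.filter fun x : F => a * f x + b * x + c = 0) = {x, y + x} := by
    ext w
    simp only [mem_filter, mem_univ, true_and, mem_insert, mem_singleton]
    constructor
    · intro hw
      by_cases hwx : w = x
      · exact Or.inl hwx
      · right
        have h := (hchord (w - x) (sub_ne_zero.2 hwx)).2 (by simpa using hw)
        rw [← hyu _ h]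
        ring
    · rintro (rfl | rfl)
      · exact hx
      · exact (hchord y hy0).1 hy
  rw [this, card_pair]
  simpa using hy0

theorem card_zeroCoords_eq_zero_or_two [CharP F 2] (hq : 2 < Fintype.card F)
    (hbij : Function.Bijective f)
    (hoval : ∀ a : F,
      Function.Bijective fun x : F => (f (x + a) + f a) * x ^ (Fintype.card F - 2))
    {p : F × F × F} (hp : p ≠ 0) :
    (zeroCoords f p).card = 0 ∨ (zeroCoords f p).card = 2 := by
  obtain ⟨a, b, c⟩ := p
  rw [card_zeroCoords_eq]
  have hone : ∀ g : F → F, Function.Bijective g → ∀ s : F, s ≠ 0 →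
      (univ.filter fun x : F => s * g x + c = 0).card = 1 := by
    intro g hg s hs
    obtain ⟨x, hx, hxu⟩ := hg.existsUnique (-c / s)
    rw [card_eq_one]
    refine ⟨x, ?_⟩
    ext w
    have hiff : s * g w + c = 0 ↔ g w = -c / s := by
      rw [eq_div_iff hs, eq_neg_iff_add_eq_zero, mul_comm]
    simp only [mem_filter, mem_univ, true_and, mem_singleton, hiff]
    exact ⟨fun h => hxu w h, fun h => h ▸ hx⟩
  by_cases ha : a = 0 <;> by_cases hb : b = 0
  · have hc : c ≠ 0 := by
      rintro rfl
      exact hp (by simp [ha, hb])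
    simp [ha, hb, hc]
  · have := hone id Function.bijective_id b hb
    simp_all
  · have := hone f hbij a ha
    simp_all
  · simpa [ha, hb] using card_oval_line_eq_zero_or_two f hq hoval ha hb c

end

theorem card_codewords_subtype {F : Type} [Field F] [Fintype F] (f : F → F)
    (P : (F ⊕ Fin 2 → F) → Prop) [DecidablePred P] :
    Nat.card {v : F ⊕ Fin 2 → F // (∃ p : F × F × F, v = Eword f p) ∧ P v} =
      (univ.filter fun p : F × F × F => P (Eword f p)).card := by
  rw [← Fintype.card_subtype, ← Nat.card_eq_fintype_card]
  refine (Nat.card_congr (Equiv.ofBijective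
    (fun p : {p : F × F × F // P (Eword f p)} =>
      (⟨Eword f p.1, ⟨p.1, rfl⟩, p.2⟩ :
        {v : F ⊕ Fin 2 → F // (∃ p : F × F × F, v = Eword f p) ∧ P v})) ⟨?_, ?_⟩)).symm
  · intro p p' h
    exact Subtype.ext (Eword_injective f (congrArg Subtype.val h))
  · rintro ⟨_, ⟨p, rfl⟩, hp⟩
    exact ⟨⟨p, hp⟩, rfl⟩

/-- **Theorem.**  Let `m ≥ 2`, `q = 2^m`, `F = GF(q)` and let `f` be an oval
polynomial over `F`.  Then `E_f` is a `[q+2, 3, q]` MDS code: the encoding map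
`(a,b,c) ↦` codeword is injective (so there are `q³` codewords and the
dimension is `3`), every nonzero codeword has Hamming weight `q` or `q+2`,
there are `(q+2)(q²-1)/2` codewords of weight `q` and `q(q-1)²/2` codewords of
weight `q+2`. -/
theorem stmt_4 (m : ℕ) (hm : 2 ≤ m)
    (F : Type) [Field F] [Fintype F] [DecidableEq F] (hcard : Fintype.card F = 2 ^ m)
    (f : F → F)
    (hbij : Function.Bijective f) (hf0 : f 0 = 0) (hf1 : f 1 = 1)
    (hoval : ∀ a : F, Function.Bijective fun x : F => (f (x + a) + f a) * x ^ (2 ^ m - 2)) :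
    Function.Injective (Eword f)
    ∧ Nat.card {v : F ⊕ Fin 2 → F // ∃ p : F × F × F, v = Eword f p} = (2 ^ m) ^ 3
    ∧ (∀ v : F ⊕ Fin 2 → F, (∃ p : F × F × F, v = Eword f p) → v ≠ 0 →
        wt v = 2 ^ m ∨ wt v = 2 ^ m + 2)
    ∧ 2 * Nat.card {v : F ⊕ Fin 2 → F //
          (∃ p : F × F × F, v = Eword f p) ∧ wt v = 2 ^ m}
        = (2 ^ m + 2) * ((2 ^ m) ^ 2 - 1)
    ∧ 2 * Nat.card {v : F ⊕ Fin 2 → F //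
          (∃ p : F × F × F, v = Eword f p) ∧ wt v = 2 ^ m + 2}
        = 2 ^ m * (2 ^ m - 1) ^ 2 := by
  rw [← hcard] at hoval ⊢
  have hq : 2 < Fintype.card F := by
    rw [hcard]
    calc 2 < 2 ^ 2 := by norm_num
      _ ≤ 2 ^ m := Nat.pow_le_pow_right (by norm_num) hm
  have : Fact (Nat.Prime 2) := ⟨Nat.prime_two⟩
  have : CharP F 2 := charP_of_card_eq_prime_pow hcard
  have hcoords := fun p (hp : p ≠ 0) => card_zeroCoords_eq_zero_or_two f hq hbij hoval (p := p) hp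
  have hwt := card_zeroCoords_add_wt f
  have hcard3 : Fintype.card (F × F × F) = Fintype.card F ^ 3 := by
    simp only [Fintype.card_prod]
    ring
  have hzero : (zeroCoords f 0).card = Fintype.card F + 2 := by
    simp [zeroCoords, Eword_zero]
  have hA : 2 * (univ.filter fun p => wt (Eword f p) = Fintype.card F).card
      = (Fintype.card F + 2) * (Fintype.card F ^ 2 - 1) := by
    have hpt : ∀ p, (zeroCoords f p).card =
        (if wt (Eword f p) = Fintype.card F then 2 else 0) +
          if p = 0 then Fintype.card F + 2 else 0 := by
      intro p
      have := hwt p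
      by_cases hp : p = 0
      · subst hp
        rw [if_neg (by omega), if_pos rfl, hzero, zero_add]
      · rw [if_neg hp]
        rcases hcoords p hp with h | h <;> split_ifs <;> omega
    have hsum := sum_card_zeroCoords f
    rw [sum_congr rfl fun p _ => hpt p, sum_add_distrib, sum_ite_eq' univ 0, if_pos (mem_univ _),
      ← sum_filter, sum_const, smul_eq_mul] at hsum
    rw [Nat.mul_sub]
    omega
  have hAB : (univ.filter fun p => wt (Eword f p) = Fintype.card F).card +
      (univ.filter fun p => wt (Eword f p) = Fintype.card F + 2).card + 1
        = Fintype.card F ^ 3 := by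
    rw [← hcard3, ← card_univ (α := F × F × F), card_eq_sum_ones (univ : Finset (F × F × F)), card_filter,
      card_filter]
    have hpt : ∀ p : F × F × F, 1 = ((if wt (Eword f p) = Fintype.card F then 1 else 0) +
        if wt (Eword f p) = Fintype.card F + 2 then 1 else 0) + if p = 0 then 1 else 0 := by
      intro p
      have := hwt p
      by_cases hp : p = 0
      · subst hp
        rw [if_neg (by omega), if_neg (by omega), if_pos rfl]
      · rw [if_neg hp]
        rcases hcoords p hp with h | h <;> split_ifs <;> omega
    rw [sum_congr rfl fun p (_ : p ∈ univ) => hpt p, sum_add_distrib, sum_add_distrib,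
      sum_ite_eq' univ 0, if_pos (mem_univ _)]
  refine ⟨Eword_injective f, ?_, ?_, ?_, ?_⟩
  · have := card_codewords_subtype f fun _ => True
    simpa [hcard3] using this
  · rintro _ ⟨p, rfl⟩ hv
    have hp : p ≠ 0 := by
      rintro rfl
      exact hv (Eword_zero f)
    have := hwt p
    rcases hcoords p hp with h | h <;> omega
  · rw [card_codewords_subtype f fun v => wt v = Fintype.card F, hA]
  · rw [card_codewords_subtype f fun v => wt v = Fintype.card F + 2]
    generalize (univ.filter fun p => wt (Eword f p) = Fintype.card F).card = A at *
    generalize (univ.filter fun p => wt (Eword f p) = Fintype.card F + 2).card = B at *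
    obtain ⟨n, hn⟩ : ∃ n, Fintype.card F = n + 1 := ⟨Fintype.card F - 1, by omega⟩
    rw [hn] at hA hAB ⊢
    rw [show (n + 1) ^ 2 - 1 = n ^ 2 + 2 * n by rw [add_sq]; omega] at hA
    rw [Nat.add_sub_cancel]
    nlinarith
end

section
/- Let m ≥ 3, q = 2^m, F = GF(q), and let f : F → F be an oval polynomial. Then the extended code Ē_f is a near MDS code with parameters [q+3, 3, q]: the map (a,b,c) ↦ codeword is injective (so Ē_f has dimension 3), the minimum Hamming weight of a nonzero codeword of Ē_f is q, and the minimum Hamming weight of a nonzero codeword of the dual code Ē_f^⊥ is 3. -/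
/-- The codeword of the extended code `Ē_f` of length `q+3` associated to
`(a,b,c) ∈ F³`: the vector `((a·f(x)+b·x+c)_{x ∈ F}, a, b, a+b)`. -/
def Ebarword {F : Type} [Field F] (f : F → F) (p : F × F × F) : F ⊕ Fin 3 → F :=
  Sum.elim (fun x => p.1 * f x + p.2.1 * x + p.2.2) ![p.1, p.2.1, p.1 + p.2.1]

/-- An affine functional with nonzero leading coefficient vanishes on at most two points of the
graph of an oval polynomial. -/
theorem card_zeros_le_two {F : Type} [Field F] [Fintype F] [DecidableEq F] (h2 : (2 : F) = 0)
    (f : F → F)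
    (hoval : ∀ a : F, Function.Injective
      fun x : F => (f (x + a) + f a) * x ^ (Fintype.card F - 2))
    (a b c : F) (ha : a ≠ 0) :
    (Finset.univ.filter fun x => a * f x + b * x + c = 0).card ≤ 2 := by
  by_contra! h
  obtain ⟨x, hx, y, hy, z, hz, hxy, hxz, hyz⟩ := Finset.two_lt_card.mp h
  simp only [Finset.mem_filter, Finset.mem_univ, true_and] at hx hy hz
  have slope : ∀ w, a * f w + b * w + c = 0 → x ≠ w →
      (f ((w + x) + x) + f x) * (w + x) ^ (Fintype.card F - 2) = b / a := by
    intro w hw hne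
    have hw0 : w + x ≠ 0 := fun h0 => hne (by linear_combination -h0 + x * h2)
    have hpow : (w + x) ^ (Fintype.card F - 2) * (w + x) = 1 := by
      have hc := Fintype.one_lt_card (α := F)
      rw [← pow_succ, show Fintype.card F - 2 + 1 = Fintype.card F - 1 by omega]
      exact FiniteField.pow_card_sub_one_eq_one _ hw0
    rw [show (w + x) + x = w by linear_combination x * h2, eq_div_iff ha]
    linear_combination (w + x) ^ (Fintype.card F - 2) * (hw + hx) - b * hpow
      - (b + c * (w + x) ^ (Fintype.card F - 2)) * h2
  have hyz_eq := hoval x ((slope y hy hxy).trans (slope z hz hxz).symm)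
  exact hyz (add_right_cancel hyz_eq)

/-- The weight of a codeword, counted separately on the affine and the three extra positions. -/
theorem wt_Ebarword_add_card_zeros {F : Type} [Field F] [Fintype F] [DecidableEq F] (f : F → F)
    (a b c : F) :
    wt (Ebarword f (a, b, c)) + (Finset.univ.filter fun x => a * f x + b * x + c = 0).card
      = Fintype.card F
        + ((if a = 0 then 0 else 1) + (if b = 0 then 0 else 1) + if a + b = 0 then 0 else 1) := by
  have hsplit := Finset.card_filter_add_card_filter_not (s := (Finset.univ : Finset F))
    (fun x => a * f x + b * x + c = 0)
  rw [Finset.card_univ] at hsplit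
  have hwt : wt (Ebarword f (a, b, c))
      = (Finset.univ.filter fun x => ¬ (a * f x + b * x + c = 0)).card
        + ((if a = 0 then 0 else 1) + (if b = 0 then 0 else 1) + if a + b = 0 then 0 else 1) := by
    rw [wt, Finset.card_filter, Finset.card_filter, Fintype.sum_sum_type, Fin.sum_univ_three]
    congr! 1
    exact congrArg₂ _ (congrArg₂ _ (ite_not (a = 0) 1 0) (ite_not (b = 0) 1 0))
      (ite_not (a + b = 0) 1 0)
  omega

/-- Nonzero codewords have weight at least the field size. -/
theorem card_le_wt_Ebarword {F : Type} [Field F] [Fintype F] [DecidableEq F] (h2 : (2 : F) = 0)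
    (f : F → F)
    (hoval : ∀ a : F, Function.Injective
      fun x : F => (f (x + a) + f a) * x ^ (Fintype.card F - 2))
    (p : F × F × F) (hp : p ≠ 0) : Fintype.card F ≤ wt (Ebarword f p) := by
  obtain ⟨a, b, c⟩ := p
  have key := wt_Ebarword_add_card_zeros f a b c
  by_cases ha : a = 0
  · subst ha
    have hz : (Finset.univ.filter fun x => (0 : F) * f x + b * x + c = 0).card
        ≤ if b = 0 then 0 else 1 := by
      split_ifs with hb
      · subst hb
        have hc : c ≠ 0 := fun h => hp (by rw [h]; rfl)
        simp [hc]
      · refine Finset.card_le_one.mpr fun x hx y hy => ?_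
        simp only [Finset.mem_filter, Finset.mem_univ, true_and] at hx hy
        exact mul_left_cancel₀ hb (by linear_combination hx - hy)
    omega
  · have hz := card_zeros_le_two h2 f hoval a b c ha
    by_cases hb : b = 0
    · subst hb
      simp only [add_zero, ha, if_true, if_false] at key hz
      omega
    · simp only [ha, hb, if_false] at key
      omega

/-- Any two coordinates of the code are separated by some codeword. -/
theorem exists_Ebarword_ne_zero_eq_zero {F : Type} [Field F] (f : F → F) {i j : F ⊕ Fin 3}
    (hij : i ≠ j) : ∃ p, Ebarword f p i ≠ 0 ∧ Ebarword f p j = 0 := by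
  rcases i with x | k <;> rcases j with y | l
  · have hxy : x ≠ y := fun h => hij (by rw [h])
    exact ⟨(0, 1, -y), by simpa [Ebarword, ← sub_eq_add_neg, sub_eq_zero] using hxy,
      by simp [Ebarword]⟩
  · exact ⟨(0, 0, 1), by simp [Ebarword], by fin_cases l <;> simp [Ebarword]⟩
  · fin_cases k
    · exact ⟨(1, 0, -f y), by simp [Ebarword], by simp [Ebarword]⟩
    · exact ⟨(0, 1, -y), by simp [Ebarword], by simp [Ebarword]⟩
    · exact ⟨(1, 0, -f y), by simp [Ebarword], by simp [Ebarword]⟩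
  · fin_cases k <;> fin_cases l
    · exact absurd rfl hij
    · exact ⟨(1, 0, 0), by simp [Ebarword], by simp [Ebarword]⟩
    · exact ⟨(1, -1, 0), by simp [Ebarword], by simp [Ebarword]⟩
    · exact ⟨(0, 1, 0), by simp [Ebarword], by simp [Ebarword]⟩
    · exact absurd rfl hij
    · exact ⟨(1, -1, 0), by simp [Ebarword], by simp [Ebarword]⟩
    · exact ⟨(0, 1, 0), by simp [Ebarword], by simp [Ebarword]⟩
    · exact ⟨(1, 0, 0), by simp [Ebarword], by simp [Ebarword]⟩
    · exact absurd rfl hij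

/-- Nonzero words of the dual code have weight at least three. -/
theorem three_le_wt_of_dual {F : Type} [Field F] [Fintype F] [DecidableEq F] (f : F → F)
    (v : F ⊕ Fin 3 → F) (hv : ∀ p, ∑ i, v i * Ebarword f p i = 0) (hv0 : v ≠ 0) : 3 ≤ wt v := by
  by_contra! h
  obtain ⟨i, hi⟩ := Function.ne_iff.mp hv0
  have hmem : i ∈ Finset.univ.filter fun i => v i ≠ 0 := by simpa using hi
  have hcard : ((Finset.univ.filter fun i => v i ≠ 0).erase i).card ≤ 1 := by
    rw [Finset.card_erase_of_mem hmem]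
    unfold wt at h
    omega
  obtain ⟨j, hj⟩ : ∃ j, i ≠ j ∧ ∀ k, k ≠ i → k ≠ j → v k = 0 := by
    by_cases hex : ∃ j, j ≠ i ∧ v j ≠ 0
    · obtain ⟨j, hji, hvj⟩ := hex
      refine ⟨j, hji.symm, fun k hki hkj => ?_⟩
      by_contra hvk
      exact hkj (Finset.card_le_one.mp hcard k (by simp [hki, hvk]) j (by simp [hji, hvj]))
    · push Not at hex
      have : Nontrivial (F ⊕ Fin 3) := ⟨Sum.inl 0, Sum.inr 0, Sum.inl_ne_inr⟩
      obtain ⟨j, hj⟩ := exists_ne i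
      exact ⟨j, hj.symm, fun k hki _ => hex k hki⟩
  obtain ⟨p, hpi, hpj⟩ := exists_Ebarword_ne_zero_eq_zero f hj.1
  have hsum := hv p
  rw [Finset.sum_eq_single i] at hsum
  · exact mul_ne_zero hi hpi hsum
  · intro k _ hki
    by_cases hkj : k = j
    · rw [hkj, hpj, mul_zero]
    · rw [hj.2 k hki hkj, zero_mul]
  · simp

/-- The encoding map is injective. -/
theorem Ebarword_injective {F : Type} [Field F] (f : F → F) :
    Function.Injective (Ebarword f) := by
  rintro ⟨a, b, c⟩ ⟨a', b', c'⟩ h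
  have ha : a = a' := congrFun h (Sum.inr 0)
  have hb : b = b' := congrFun h (Sum.inr 1)
  have hc : a * f 0 + b * 0 + c = a' * f 0 + b' * 0 + c' := congrFun h (Sum.inl 0)
  subst ha hb
  rw [add_left_cancel hc]

/-- **Theorem 9 (Theorem `thm-J271`).**  Let `m ≥ 3`, `q = 2^m`, `F = GF(q)` and
let `f` be an oval polynomial over `F`.  Then the extended code `Ē_f` is an
NMDS code with parameters `[q+3, 3, q]`: the encoding map is injective (so the
dimension is `3`), the minimum Hamming weight of a nonzero codeword of `Ē_f`
is `q`, and the minimum Hamming weight of a nonzero codeword of the dual code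
`Ē_f^⊥` is `3`. -/
theorem stmt_5 (m : ℕ) (hm : 3 ≤ m)
    (F : Type) [Field F] [Fintype F] [DecidableEq F] (hcard : Fintype.card F = 2 ^ m)
    (f : F → F)
    (hbij : Function.Bijective f) (hf0 : f 0 = 0) (hf1 : f 1 = 1)
    (hoval : ∀ a : F, Function.Bijective fun x : F => (f (x + a) + f a) * x ^ (2 ^ m - 2)) :
    Function.Injective (Ebarword f)
    ∧ (∀ v : F ⊕ Fin 3 → F, (∃ p : F × F × F, v = Ebarword f p) → v ≠ 0 →
        2 ^ m ≤ wt v)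
    ∧ (∃ v : F ⊕ Fin 3 → F, (∃ p : F × F × F, v = Ebarword f p) ∧ v ≠ 0 ∧
        wt v = 2 ^ m)
    ∧ (∀ v : F ⊕ Fin 3 → F, (∀ p : F × F × F, ∑ i, v i * Ebarword f p i = 0) →
        v ≠ 0 → 3 ≤ wt v)
    ∧ (∃ v : F ⊕ Fin 3 → F, (∀ p : F × F × F, ∑ i, v i * Ebarword f p i = 0) ∧
        v ≠ 0 ∧ wt v = 3) := by
  have h2 : (2 : F) = 0 := by
    have h := Nat.cast_card_eq_zero F
    rw [hcard, Nat.cast_pow, Nat.cast_ofNat] at h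
    exact eq_zero_of_pow_eq_zero h
  have hinj : ∀ a : F, Function.Injective
      fun x : F => (f (x + a) + f a) * x ^ (Fintype.card F - 2) := by
    rw [hcard]
    exact fun a => (hoval a).injective
  have hzero : Ebarword f 0 = 0 := by
    funext i
    rcases i with x | k
    · simp [Ebarword]
    · fin_cases k <;> simp [Ebarword]
  refine ⟨Ebarword_injective f, ?_, ?_, three_le_wt_of_dual f, ?_⟩
  · rintro v ⟨p, rfl⟩ hv
    rw [← hcard]
    exact card_le_wt_Ebarword h2 f hinj p fun hp => hv (by rw [hp, hzero])
  · refine ⟨Ebarword f (0, 0, 1), ⟨_, rfl⟩, fun h => ?_, ?_⟩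
    · simpa [Ebarword] using congrFun h (Sum.inl 0)
    · have key := wt_Ebarword_add_card_zeros f 0 0 1
      simpa [hcard] using key
  · refine ⟨Sum.elim 0 ![1, 1, -1], fun p => ?_, fun h => ?_, ?_⟩
    · simp [Ebarword, Fin.sum_univ_three]
    · simpa using congrFun h (Sum.inr 0)
    · simp [wt, Finset.card_filter, Fin.sum_univ_three]
end

section
/- Let m ≥ 3 be odd, q = 2^m, F = GF(q), and let f : F → F be an oval polynomial such that f(x^2) = f(x)^2 for all x ∈ F. Then the dual code C_f^⊥ has parameters [q+1, q-2, 3]: it has dimension q-2 and the minimum Hamming weight of a nonzero codeword of C_f^⊥ is 3. -/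
/-- The codeword of the code `C_f` of length `q+1` associated to `(a,b,c) ∈ F³`:
the vector `((a·f(x)+b·x+c)_{x ∈ F, x ≠ 0}, b+c, a+c)`. -/
def Cword {F : Type} [Field F] (f : F → F) (p : F × F × F) :
    {x : F // x ≠ 0} ⊕ Fin 2 → F :=
  Sum.elim (fun x => p.1 * f x.1 + p.2.1 * x.1 + p.2.2) ![p.2.1 + p.2.2, p.1 + p.2.2]

/-- Vectors orthogonal to the all-one vector and to two coordinate functions that jointly separate
the positions have at least three nonzero entries. -/
theorem three_le_wt {ι F : Type} [Fintype ι] [DecidableEq F] [Field F] (X Y v : ι → F)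
    (hinj : ∀ i j, X i = X j → Y i = Y j → i = j)
    (h1 : ∑ i, v i = 0) (hX : ∑ i, v i * X i = 0) (hY : ∑ i, v i * Y i = 0) (hv : v ≠ 0) :
    3 ≤ wt v := by
  classical
  set s : Finset ι := Finset.univ.filter fun i => v i ≠ 0 with hs
  have hsum : ∀ Z : ι → F, ∑ i, v i * Z i = ∑ i ∈ s, v i * Z i := fun Z => by
    refine (Finset.sum_subset (Finset.subset_univ s) fun i _ hi => ?_).symm
    have : v i = 0 := by simpa [hs] using hi
    simp [this]
  have hmem : ∀ i, i ∈ s ↔ v i ≠ 0 := fun i => by simp [hs]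
  have h1' : ∑ i ∈ s, v i = 0 := by simpa [h1] using (hsum 1).symm
  rw [hsum] at hX hY
  change 3 ≤ s.card
  by_contra hlt
  obtain h | h | h : s.card = 0 ∨ s.card = 1 ∨ s.card = 2 := by omega
  · rw [Finset.card_eq_zero] at h
    refine hv (funext fun i => ?_)
    by_contra hi
    simpa [h] using (hmem i).2 hi
  · obtain ⟨i, hi⟩ := Finset.card_eq_one.1 h
    exact (hmem i).1 (by simp [hi]) (by simpa [hi] using h1')
  · obtain ⟨i, j, hij, hs2⟩ := Finset.card_eq_two.1 h
    have hvi : v i ≠ 0 := (hmem i).1 (by simp [hs2])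
    rw [hs2, Finset.sum_pair hij] at h1' hX hY
    have hcancel : ∀ Z : ι → F, v i * Z i + v j * Z j = 0 → Z i = Z j := fun Z hZ =>
      mul_left_cancel₀ hvi (by linear_combination hZ - Z j * h1')
    exact hij (hinj i j (hcancel X hX) (hcancel Y hY))

section

variable {F : Type} [Field F]

theorem sum_mul_Cword [Fintype F] [DecidableEq F] (f : F → F)
    (v : {x : F // x ≠ 0} ⊕ Fin 2 → F) (p : F × F × F) :
    ∑ i, v i * Cword f p i = p.1 * ∑ i, v i * Cword f (1, 0, 0) i +
      p.2.1 * ∑ i, v i * Cword f (0, 1, 0) i + p.2.2 * ∑ i, v i * Cword f (0, 0, 1) i := by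
  simp only [Finset.mul_sum, ← Finset.sum_add_distrib]
  refine Finset.sum_congr rfl fun i _ => ?_
  rcases i with x | k
  · simp [Cword]; ring
  · fin_cases k <;> simp [Cword] <;> ring

theorem Cword_zero_zero_one (f : F → F) (i : {x : F // x ≠ 0} ⊕ Fin 2) :
    Cword f (0, 0, 1) i = 1 := by
  rcases i with x | k
  · simp [Cword]
  · fin_cases k <;> simp [Cword]

theorem Cword_separates {f : F → F} (hf1 : f 1 = 1) (i j : {x : F // x ≠ 0} ⊕ Fin 2)
    (hX : Cword f (1, 0, 0) i = Cword f (1, 0, 0) j)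
    (hY : Cword f (0, 1, 0) i = Cword f (0, 1, 0) j) : i = j := by
  rcases i with ⟨x, hx⟩ | k <;> rcases j with ⟨y, hy⟩ | l
  · simpa [Cword] using hY
  · fin_cases l <;> simp_all [Cword]
  · fin_cases k <;> simp [Cword] at hX hY
    · subst hY; simp [hf1] at hX
    · exact absurd hY.symm hy
  · fin_cases k <;> fin_cases l <;> simp_all [Cword]

/-- The syndrome map, whose kernel is the dual of the code of `f`. -/
def syndrome [Fintype F] [DecidableEq F] (f : F → F) :
    ({x : F // x ≠ 0} ⊕ Fin 2 → F) →ₗ[F] F × F × F where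
  toFun v := (∑ i, v i * Cword f (1, 0, 0) i, ∑ i, v i * Cword f (0, 1, 0) i,
    ∑ i, v i * Cword f (0, 0, 1) i)
  map_add' v w := by simp only [Pi.add_apply, add_mul, Finset.sum_add_distrib, Prod.mk_add_mk]
  map_smul' c v := by
    simp only [Pi.smul_apply, smul_eq_mul, mul_assoc, ← Finset.mul_sum, RingHom.id_apply,
      Prod.smul_mk]

theorem mem_ker_syndrome [Fintype F] [DecidableEq F] (f : F → F)
    (v : {x : F // x ≠ 0} ⊕ Fin 2 → F) :
    v ∈ LinearMap.ker (syndrome f) ↔ ∀ p : F × F × F, ∑ i, v i * Cword f p i = 0 := by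
  rw [LinearMap.mem_ker]
  refine ⟨fun h p => ?_, fun h => ?_⟩
  · simp only [syndrome, LinearMap.coe_mk, AddHom.coe_mk, Prod.mk_eq_zero] at h
    rw [sum_mul_Cword, h.1, h.2.1, h.2.2]
    ring
  · simp only [syndrome, LinearMap.coe_mk, AddHom.coe_mk, h, Prod.mk_zero_zero]

theorem sum_single_mul [Fintype F] [DecidableEq F] {i : {x : F // x ≠ 0} ⊕ Fin 2} (c : F)
    (g : {x : F // x ≠ 0} ⊕ Fin 2 → F) :
    ∑ k, (Pi.single i c : {x : F // x ≠ 0} ⊕ Fin 2 → F) k * g k = c * g i := by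
  rw [Finset.sum_eq_single i (fun k _ hk => by simp [hk]) (by simp), Pi.single_eq_same]

theorem syndrome_surjective [Fintype F] [DecidableEq F] {f : F → F} (hf1 : f 1 = 1) :
    Function.Surjective (syndrome f) := by
  rintro ⟨a, b, c⟩
  refine ⟨Pi.single (Sum.inl ⟨1, one_ne_zero⟩) (a + b - c) + Pi.single (Sum.inr 0) (c - a) +
    Pi.single (Sum.inr 1) (c - b), ?_⟩
  simp only [syndrome, LinearMap.coe_mk, AddHom.coe_mk, Pi.add_apply, add_mul,
    Finset.sum_add_distrib, sum_single_mul]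
  simp only [Cword, hf1, Sum.elim_inl, Sum.elim_inr, Matrix.cons_val_zero, Matrix.cons_val_one,
    Prod.mk.injEq]
  refine ⟨?_, ?_, ?_⟩ <;> simp

theorem card_ker_syndrome [Fintype F] [DecidableEq F] {f : F → F} (hf1 : f 1 = 1) :
    Nat.card (LinearMap.ker (syndrome f)) = Fintype.card F ^ (Fintype.card F - 2) := by
  have h := (syndrome f).finrank_range_add_finrank_ker
  rw [LinearMap.range_eq_top.2 (syndrome_surjective hf1), finrank_top, Module.finrank_prod,
    Module.finrank_prod, Module.finrank_self, Module.finrank_fintype_fun_eq_card,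
    Fintype.card_sum, Fintype.card_fin] at h
  have hunits : Fintype.card {x : F // x ≠ 0} = Fintype.card F - 1 := by
    simp [Fintype.card_subtype_compl]
  have hone : 1 < Fintype.card F := Fintype.one_lt_card
  rw [Module.natCard_eq_pow_finrank (K := F), Nat.card_eq_fintype_card]
  congr 1
  omega

/-- In the affine plane of an oval polynomial over a field of even order `q > 2`, some line through
`(1, 0)` meets the graph of `f` twice outside the points over `0` and `1`. -/
theorem exists_secant [Fintype F] [DecidableEq F] [CharP F 2] {f : F → F}
    (hq : 2 < Fintype.card F) (hbij : Function.Bijective f) (hf0 : f 0 = 0) (hf1 : f 1 = 1)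
    (hoval : ∀ a : F, Function.Bijective
      fun x : F => (f (x + a) + f a) * x ^ (Fintype.card F - 2)) :
    ∃ x y : F, x ≠ 0 ∧ y ≠ 0 ∧ x ≠ 1 ∧ y ≠ 1 ∧ x ≠ y ∧ f x * (y + 1) = f y * (x + 1) := by
  obtain ⟨x, -, hx⟩ : ∃ x ∈ (Finset.univ : Finset F), x ∉ ({0, 1} : Finset F) :=
    Finset.exists_mem_notMem_of_card_lt_card
      (lt_of_le_of_lt Finset.card_le_two (by simpa using hq))
  obtain ⟨hx0, hx1⟩ : x ≠ 0 ∧ x ≠ 1 := by simpa using hx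
  have hx1' : x + 1 ≠ 0 := fun h => hx1 (CharTwo.add_eq_zero.1 h)
  have hfx : f x ≠ 0 := fun h => hx0 (hbij.1 (h.trans hf0.symm))
  obtain ⟨h, hh⟩ := (hoval x).2 (f x / (x + 1))
  have hs : f x / (x + 1) ≠ 0 := div_ne_zero hfx hx1'
  have hh0 : h ≠ 0 := by
    rintro rfl
    refine hs (hh.symm.trans ?_)
    simp [CharTwo.add_self_eq_zero]
  have hinv : h * h ^ (Fintype.card F - 2) = 1 := by
    rw [← pow_succ', show Fintype.card F - 2 + 1 = Fintype.card F - 1 by omega]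
    exact FiniteField.pow_card_sub_one_eq_one h hh0
  have two : (2 : F) = 0 := CharTwo.two_eq_zero
  have hline : f x * (h + x + 1) = f (h + x) * (x + 1) := by
    rw [eq_div_iff hx1'] at hh
    linear_combination (-h) * hh + (f (h + x) + f x) * (x + 1) * hinv
      + f x * (x + 1) * two
  refine ⟨x, h + x, hx0, ?_, hx1, ?_, by simpa using hh0, hline⟩
  · intro h0
    rw [h0, hf0] at hline
    exact hfx (by simpa using hline)
  · intro h1
    rw [h1, hf1] at hline
    exact hx1' (by linear_combination -hline + f x * two)

theorem exists_dual_wt_three [Fintype F] [DecidableEq F] [CharP F 2] (f : F → F) {x y : F}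
    (hx0 : x ≠ 0) (hy0 : y ≠ 0) (hx1 : x ≠ 1) (hy1 : y ≠ 1) (hxy : x ≠ y)
    (hline : f x * (y + 1) = f y * (x + 1)) :
    ∃ v : {x : F // x ≠ 0} ⊕ Fin 2 → F,
      (∀ p : F × F × F, ∑ i, v i * Cword f p i = 0) ∧ v ≠ 0 ∧ wt v = 3 := by
  have two : (2 : F) = 0 := CharTwo.two_eq_zero
  have hx1' : x + 1 ≠ 0 := fun h => hx1 (CharTwo.add_eq_zero.1 h)
  have hy1' : y + 1 ≠ 0 := fun h => hy1 (CharTwo.add_eq_zero.1 h)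
  have hxy' : x + y ≠ 0 := fun h => hxy (CharTwo.add_eq_zero.1 h)
  set v : {x : F // x ≠ 0} ⊕ Fin 2 → F := Pi.single (Sum.inl ⟨x, hx0⟩) (y + 1) +
    Pi.single (Sum.inl ⟨y, hy0⟩) (x + 1) + Pi.single (Sum.inr 0) (x + y) with hv
  have hwt : wt v = 3 := by
    have hsupp : (Finset.univ.filter fun i => v i ≠ 0) =
        {Sum.inl ⟨x, hx0⟩, Sum.inl ⟨y, hy0⟩, Sum.inr 0} := by
      ext i
      rcases i with ⟨z, hz⟩ | k
      · by_cases hzx : z = x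
        · subst hzx; simp [hv, Pi.single_apply, hxy, hy1']
        · by_cases hzy : z = y
          · subst hzy; simp [hv, Pi.single_apply, hzx, hx1']
          · simp [hv, Pi.single_apply, hzx, hzy]
      · fin_cases k <;> simp [hv, hxy']
    rw [wt, hsupp]
    exact Finset.card_eq_three.2 ⟨_, _, _, by simpa using hxy, by simp, by simp, rfl⟩
  refine ⟨v, fun p => ?_, ?_, hwt⟩
  · simp only [hv, Pi.add_apply, add_mul, Finset.sum_add_distrib, sum_single_mul]
    simp only [Cword, Sum.elim_inl, Sum.elim_inr, Matrix.cons_val_zero]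
    linear_combination p.1 * hline + (p.1 * f y * (x + 1) + p.2.1 * (x * y + x + y) +
      p.2.2 * (x + y + 1)) * two
  · intro h
    simp [h, wt] at hwt

end

/-- **Theorem.**  Let `m ≥ 3` be odd, `q = 2^m`, `F = GF(q)` and let `f` be an
oval polynomial over `F` with `f(x²) = f(x)²` for all `x` (i.e. coefficients in
`GF(2)`).  Then the dual code `C_f^⊥` has parameters `[q+1, q-2, 3]`: it has
`q^(q-2)` codewords (dimension `q-2`) and the minimum Hamming weight of a
nonzero codeword of `C_f^⊥` is `3`. -/
theorem stmt_9 (m : ℕ) (hm : 3 ≤ m) (hmodd : Odd m)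
    (F : Type) [Field F] [Fintype F] [DecidableEq F] (hcard : Fintype.card F = 2 ^ m)
    (f : F → F)
    (hbij : Function.Bijective f) (hf0 : f 0 = 0) (hf1 : f 1 = 1)
    (hoval : ∀ a : F, Function.Bijective fun x : F => (f (x + a) + f a) * x ^ (2 ^ m - 2))
    (hfrob : ∀ x : F, f (x ^ 2) = f x ^ 2) :
    Nat.card {v : {x : F // x ≠ 0} ⊕ Fin 2 → F //
        ∀ p : F × F × F, ∑ i, v i * Cword f p i = 0} = (2 ^ m) ^ (2 ^ m - 2)
    ∧ (∀ v : {x : F // x ≠ 0} ⊕ Fin 2 → F,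
        (∀ p : F × F × F, ∑ i, v i * Cword f p i = 0) → v ≠ 0 → 3 ≤ wt v)
    ∧ (∃ v : {x : F // x ≠ 0} ⊕ Fin 2 → F,
        (∀ p : F × F × F, ∑ i, v i * Cword f p i = 0) ∧ v ≠ 0 ∧ wt v = 3) := by
  have hq : 2 < Fintype.card F := by
    rw [hcard]
    exact lt_of_lt_of_le (by norm_num) (Nat.pow_le_pow_right (n := 2) (by norm_num) hm)
  have : CharP F 2 := charP_of_card_eq_prime_pow hcard
  refine ⟨?_, fun v hv hv0 => ?_, ?_⟩
  · rw [← hcard, ← card_ker_syndrome hf1]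
    exact Nat.card_congr (Equiv.subtypeEquivRight fun v => (mem_ker_syndrome f v).symm)
  · exact three_le_wt _ _ v (Cword_separates hf1)
      (by simpa [Cword_zero_zero_one] using hv (0, 0, 1)) (hv (1, 0, 0)) (hv (0, 1, 0)) hv0
  · rw [← hcard] at hoval
    obtain ⟨x, y, hx0, hy0, hx1, hy1, hxy, hline⟩ := exists_secant hq hbij hf0 hf1 hoval
    exact exists_dual_wt_three f hx0 hy0 hx1 hy1 hxy hline
end

section
/- Let m ≥ 3 be odd, q = 2^m, F = GF(q), and let f : F → F be an oval polynomial such that f(x^2) = f(x)^2 for all x ∈ F. Then the number of codewords of Hamming weight 3 in the dual code C_f^⊥ is exactly (q-1)(q-2). -/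
section OvalCode

variable {F : Type} [Field F] {f : F → F}

/-- The first affine coordinate of the point of the plane attached to a position of `C_f`. -/
def ovalFst (f : F → F) : {x : F // x ≠ 0} ⊕ Fin 2 → F :=
  Sum.elim (fun x => f x.1) ![0, 1]

/-- The second affine coordinate of the point of the plane attached to a position of `C_f`. -/
def ovalSnd : {x : F // x ≠ 0} ⊕ Fin 2 → F :=
  Sum.elim (fun x => x.1) ![1, 0]

lemma Cword_apply (p : F × F × F) (i : {x : F // x ≠ 0} ⊕ Fin 2) :
    Cword f p i = p.1 * ovalFst f i + p.2.1 * ovalSnd i + p.2.2 := by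
  rcases i with x | j
  · rfl
  · fin_cases j <;> simp [Cword, ovalFst, ovalSnd]

lemma forall_sum_mul_Cword_eq_zero_iff [Fintype F] [DecidableEq F]
    (v : {x : F // x ≠ 0} ⊕ Fin 2 → F) :
    (∀ p : F × F × F, ∑ i, v i * Cword f p i = 0) ↔
      ∑ i, v i * ovalFst f i = 0 ∧ ∑ i, v i * ovalSnd i = 0 ∧ ∑ i, v i = 0 := by
  have h (p : F × F × F) : ∑ i, v i * Cword f p i =
      p.1 * ∑ i, v i * ovalFst f i + p.2.1 * ∑ i, v i * ovalSnd i + p.2.2 * ∑ i, v i := by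
    simp only [Finset.mul_sum, ← Finset.sum_add_distrib]
    refine Finset.sum_congr rfl fun i _ => ?_
    rw [Cword_apply]; ring
  constructor
  · intro hv
    exact ⟨by simpa [h] using hv (1, 0, 0), by simpa [h] using hv (0, 1, 0),
      by simpa [h] using hv (0, 0, 1)⟩
  · rintro ⟨h₁, h₂, h₃⟩ p
    rw [h, h₁, h₂, h₃]; ring

lemma sum_mul_eq_of_support [DecidableEq F] {ι : Type} [Fintype ι] [DecidableEq ι]
    {v : ι → F} {i j k : ι}
    (hij : i ≠ j) (hik : i ≠ k) (hjk : j ≠ k) (hv : ∀ l, v l ≠ 0 → l = i ∨ l = j ∨ l = k)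
    (w : ι → F) : ∑ l, v l * w l = v i * w i + v j * w j + v k * w k := by
  rw [← Finset.sum_subset (Finset.subset_univ {i, j, k}), Finset.sum_insert (by simp [hij, hik]),
    Finset.sum_insert (by simp [hjk]), Finset.sum_singleton, add_assoc]
  intro l _ hl
  have : v l = 0 := by
    by_contra h
    exact hl (by simpa using hv l h)
  simp [this]

lemma dual_iff_of_support [Fintype F] [DecidableEq F] {v : {x : F // x ≠ 0} ⊕ Fin 2 → F}
    {i j k : {x : F // x ≠ 0} ⊕ Fin 2} (hij : i ≠ j) (hik : i ≠ k) (hjk : j ≠ k)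
    (hv : ∀ l, v l ≠ 0 → l = i ∨ l = j ∨ l = k) :
    (∀ p : F × F × F, ∑ l, v l * Cword f p l = 0) ↔
      v i * ovalFst f i + v j * ovalFst f j + v k * ovalFst f k = 0 ∧
      v i * ovalSnd i + v j * ovalSnd j + v k * ovalSnd k = 0 ∧ v i + v j + v k = 0 := by
  have h := sum_mul_eq_of_support hij hik hjk hv
  rw [forall_sum_mul_Cword_eq_zero_iff, h, h]
  have h1 := h 1
  simp only [Pi.one_apply, mul_one] at h1
  rw [h1]

lemma exists_support_of_wt_eq_three [DecidableEq F] {ι : Type} [Fintype ι] [DecidableEq ι]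
    {v : ι → F} (hv : wt v = 3) :
    ∃ i j k, i ≠ j ∧ i ≠ k ∧ j ≠ k ∧ ∀ l, v l ≠ 0 ↔ l = i ∨ l = j ∨ l = k := by
  obtain ⟨i, j, k, hij, hik, hjk, h⟩ := Finset.card_eq_three.1 hv
  refine ⟨i, j, k, hij, hik, hjk, fun l => ?_⟩
  simpa using Finset.ext_iff.1 h l

lemma charP_two_of_card [Fintype F] {m : ℕ} (hcard : Fintype.card F = 2 ^ m) : CharP F 2 := by
  refine CharTwo.of_one_ne_zero_of_two_eq_zero one_ne_zero ?_
  have h : ((2 ^ m : ℕ) : F) = 0 := hcard ▸ Nat.cast_card_eq_zero F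
  push_cast at h
  exact eq_zero_of_pow_eq_zero h

/-- Through each point of the graph of an oval polynomial there is exactly one further point of
the graph in every direction of nonzero slope. -/
lemma existsUnique_secant [Fintype F] [CharP F 2] {m : ℕ} (hm : 2 ≤ m)
    (hcard : Fintype.card F = 2 ^ m)
    (hoval : ∀ a : F, Function.Bijective fun x : F => (f (x + a) + f a) * x ^ (2 ^ m - 2))
    (x : F) {s : F} (hs : s ≠ 0) : ∃! y, y ≠ x ∧ f y + f x = s * (y + x) := by
  have hq : 2 ^ 2 ≤ 2 ^ m := Nat.pow_le_pow_right (by norm_num) hm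
  have hinv {u : F} (hu : u ≠ 0) : u ^ (2 ^ m - 2) * u = 1 := by
    rw [← pow_succ, ← FiniteField.pow_card_sub_one_eq_one u hu, hcard]
    congr 1; omega
  have hne {y : F} (hy : y ≠ x) : y + x ≠ 0 := by rwa [Ne, CharTwo.add_eq_zero]
  obtain ⟨u, hu⟩ := (hoval x).2 s
  have hu0 : u ≠ 0 := by
    rintro rfl
    exact hs (by rw [← hu]; simp [CharTwo.add_self_eq_zero])
  refine ⟨u + x, ⟨by simpa using hu0, ?_⟩, ?_⟩
  · rw [CharTwo.add_cancel_right, ← hu]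
    linear_combination (-(f (u + x) + f x)) * hinv hu0
  · rintro y ⟨hy, hys⟩
    have : y + x = u := by
      refine (hoval x).1 (Eq.trans ?_ hu.symm)
      simp only [CharTwo.add_cancel_right, hys]
      linear_combination s * hinv (hne hy)
    rw [← this, CharTwo.add_cancel_right]

lemma add_self_ne_one_of_frobenius [Fintype F] [CharP F 2] {m : ℕ} (hmodd : Odd m)
    (hcard : Fintype.card F = 2 ^ m) (hf0 : f 0 = 0) (hf1 : f 1 = 1)
    (hsec : ∀ x s : F, s ≠ 0 → ∃! y, y ≠ x ∧ f y + f x = s * (y + x))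
    (hfrob : ∀ x : F, f (x ^ 2) = f x ^ 2) (x : F) : f x + x ≠ 1 := by
  intro hx
  have h2 : (2 : F) = 0 := CharTwo.two_eq_zero
  have hx2 : f (x ^ 2) + x ^ 2 = 1 := by
    rw [hfrob]; linear_combination (f x + x + 1) * hx - x * f x * h2
  have hx4 : f ((x ^ 2) ^ 2) + (x ^ 2) ^ 2 = 1 := by
    rw [hfrob]; linear_combination (f (x ^ 2) + x ^ 2 + 1) * hx2 - x ^ 2 * f (x ^ 2) * h2
  have hx0 : x ≠ 0 := by rintro rfl; simp [hf0] at hx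
  have hsq : x ^ 2 ≠ x := by
    intro h
    have : x = 1 := mul_left_cancel₀ hx0 (by linear_combination h)
    rw [this, hf1] at hx
    exact one_ne_zero (by linear_combination h2 - hx : (1 : F) = 0)
  have hfour : (x ^ 2) ^ 2 ≠ x := by
    intro h
    have h3 : x ^ 3 = 1 := mul_left_cancel₀ hx0 (by linear_combination h)
    obtain ⟨k, rfl⟩ := hmodd
    have hk : 2 ^ (2 * k + 1) % 3 = 2 := by
      rw [pow_succ, pow_mul, Nat.mul_mod, Nat.pow_mod]; norm_num
    apply hsq
    have hp := FiniteField.pow_card x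
    rwa [hcard, ← Nat.div_add_mod (2 ^ (2 * k + 1)) 3, hk, pow_add, pow_mul, h3, one_pow,
      one_mul] at hp
  have h := (hsec x 1 one_ne_zero).unique
    ⟨hsq, by linear_combination hx2 + hx - (x + x ^ 2 - 1) * h2⟩
    ⟨hfour, by linear_combination hx4 + hx - (x + (x ^ 2) ^ 2 - 1) * h2⟩
  refine hsq ?_
  have : (x ^ 2 - x) ^ 2 = 0 := by linear_combination -h - (x ^ 3 - x ^ 2) * h2
  linear_combination pow_eq_zero_iff (two_ne_zero) |>.1 this

lemma slope_eq_of_combination_eq_zero [CharP F 2] {α β γ x₁ x₂ x₃ y₁ y₂ y₃ : F} (hγ : γ ≠ 0)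
    (hx : α * x₁ + β * x₂ + γ * x₃ = 0) (hy : α * y₁ + β * y₂ + γ * y₃ = 0)
    (h : α + β + γ = 0) : (x₃ + x₁) * (y₂ + y₁) = (x₂ + x₁) * (y₃ + y₁) := by
  have h2 : (2 : F) = 0 := CharTwo.two_eq_zero
  refine mul_left_cancel₀ hγ ?_
  linear_combination (y₂ + y₁) * (hx - x₁ * h + x₁ * (β + γ) * h2) -
    (x₂ + x₁) * (hy - y₁ * h + y₁ * (β + γ) * h2)

/-- A dual codeword of weight three is supported on two positions `x, y ∈ F \ {0, 1}` and one of
the two extra positions. -/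
lemma exists_support_of_dual [Fintype F] [DecidableEq F] [CharP F 2]
    (hinj : Function.Injective f) (hf1 : f 1 = 1)
    (hsec : ∀ x s : F, s ≠ 0 → ∃! y, y ≠ x ∧ f y + f x = s * (y + x))
    (hline : ∀ x, f x + x ≠ 1) {v : {x : F // x ≠ 0} ⊕ Fin 2 → F}
    (hv : ∀ p : F × F × F, ∑ i, v i * Cword f p i = 0) (hwt : wt v = 3) :
    ∃ (x y : {x : F // x ≠ 0}) (j : Fin 2), x ≠ y ∧ x.1 ≠ 1 ∧ y.1 ≠ 1 ∧
      ∀ l, v l ≠ 0 ↔ l = .inl x ∨ l = .inl y ∨ l = .inr j := by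
  have htwo (x y : {x : F // x ≠ 0}) (j : Fin 2) (hxy : x ≠ y)
      (h : ∀ l, v l ≠ 0 ↔ l = .inl x ∨ l = .inl y ∨ l = .inr j) : y.1 ≠ 1 := by
    intro hy
    obtain ⟨e₁, e₂, e₃⟩ := (dual_iff_of_support (by simpa using hxy) (by simp) (by simp)
      fun l => (h l).1).1 hv
    have hx : v (.inl x) ≠ 0 := by simp [h]
    refine hxy (Subtype.ext ?_)
    rw [hy]
    fin_cases j <;> simp [ovalFst, ovalSnd, hy] at e₁ e₂ e₃
    · exact mul_left_cancel₀ hx (by linear_combination e₂ - e₃)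
    · exact hinj (mul_left_cancel₀ hx (by rw [hf1] at *; linear_combination e₁ - e₃))
  have hthree (x y : {x : F // x ≠ 0}) (j : Fin 2) (hxy : x ≠ y)
      (h : ∀ l, v l ≠ 0 ↔ l = .inl x ∨ l = .inl y ∨ l = .inr j) :
      ∃ (x y : {x : F // x ≠ 0}) (j : Fin 2), x ≠ y ∧ x.1 ≠ 1 ∧ y.1 ≠ 1 ∧
        ∀ l, v l ≠ 0 ↔ l = .inl x ∨ l = .inl y ∨ l = .inr j :=
    ⟨x, y, j, hxy, htwo y x j hxy.symm fun l => by rw [h]; tauto, htwo x y j hxy h, h⟩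
  have hone (x : {x : F // x ≠ 0}) (j k : Fin 2) (hjk : j ≠ k)
      (h : ∀ l, v l ≠ 0 ↔ l = .inl x ∨ l = .inr j ∨ l = .inr k) : False := by
    obtain ⟨e₁, e₂, e₃⟩ := (dual_iff_of_support (by simp) (by simp) (by simpa using hjk)
      fun l => (h l).1).1 hv
    have hx : v (.inl x) ≠ 0 := by simp [h]
    refine hline x (mul_left_cancel₀ hx ?_)
    fin_cases j <;> fin_cases k <;> simp [ovalFst, ovalSnd] at hjk e₁ e₂ e₃ <;>
      linear_combination e₁ + e₂ - e₃
  obtain ⟨i, j, k, hij, hik, hjk, h⟩ := exists_support_of_wt_eq_three hwt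
  rcases i with x | i <;> rcases j with y | j <;> rcases k with z | k
  · exfalso
    obtain ⟨e₁, e₂, e₃⟩ := (dual_iff_of_support hij hik hjk fun l => (h l).1).1 hv
    have hxy : y.1 ≠ x.1 := fun e => hij (by rw [Subtype.ext e])
    have hxz : z.1 ≠ x.1 := fun e => hik (by rw [Subtype.ext e])
    have hy : v (.inl y) ≠ 0 := by simp [h]
    have hz : v (.inl z) ≠ 0 := by simp [h]
    have hd {a b : F} (hab : a ≠ b) : a + b ≠ 0 := by rwa [Ne, CharTwo.add_eq_zero]
    simp only [ovalFst, ovalSnd, Sum.elim_inl] at e₁ e₂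
    refine hjk (congrArg Sum.inl (Subtype.ext ((hsec x ((f y + f x) / (y + x))
      (div_ne_zero (hd (hinj.ne hxy)) (hd hxy))).unique
        ⟨hxy, (div_mul_cancel₀ _ (hd hxy)).symm⟩ ⟨hxz, ?_⟩)))
    rw [div_mul_eq_mul_div, eq_div_iff (hd hxy)]
    exact slope_eq_of_combination_eq_zero hz e₁ e₂ e₃
  · exact hthree x y k (by simpa using hij) h
  · exact hthree x z j (by simpa using hik) fun l => by rw [h]; tauto
  · exact (hone x j k (by simpa using hjk) h).elim
  · exact hthree y z i (by simpa using hjk) fun l => by rw [h]; tauto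
  · exact (hone y i k (by simpa using hik) fun l => by rw [h]; tauto).elim
  · exact (hone z i j (by simpa using hij) fun l => by rw [h]; tauto).elim
  · exfalso
    simp only [ne_eq, Sum.inr.injEq] at hij hik hjk
    omega

/-- A position `x ∈ F \ {0, 1}`, an extra position and a nonzero coefficient at the latter
determine a dual codeword of weight three. -/
lemma existsUnique_dual [Fintype F] [DecidableEq F] [CharP F 2]
    (hinj : Function.Injective f) (hf0 : f 0 = 0)
    (hf1 : f 1 = 1) (hsec : ∀ x s : F, s ≠ 0 → ∃! y, y ≠ x ∧ f y + f x = s * (y + x))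
    (hline : ∀ x, f x + x ≠ 1) (j : Fin 2) {x : {x : F // x ≠ 0}} (hx1 : x.1 ≠ 1) {c : F}
    (hc : c ≠ 0) : ∃! v : {x : F // x ≠ 0} ⊕ Fin 2 → F,
      ((∀ p : F × F × F, ∑ i, v i * Cword f p i = 0) ∧ wt v = 3) ∧
        v (.inl x) ≠ 0 ∧ v (.inr j) = c := by
  have h2 : (2 : F) = 0 := CharTwo.two_eq_zero
  have hd {a b : F} (hab : a ≠ b) : a + b ≠ 0 := by rwa [Ne, CharTwo.add_eq_zero]
  obtain ⟨a, ha⟩ : ∃ a, ovalSnd (F := F) (.inr j) = a := ⟨_, rfl⟩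
  obtain ⟨b, hb⟩ : ∃ b, ovalFst f (.inr j) = b := ⟨_, rfl⟩
  have hab : a = 1 ∧ b = 0 ∨ a = 0 ∧ b = 1 := by
    subst ha hb
    fin_cases j <;> simp [ovalFst, ovalSnd]
  have hsnd (z : F) (hz0 : z ≠ 0) (hz1 : z ≠ 1) : z + a ≠ 0 := by
    rcases hab with ⟨rfl, -⟩ | ⟨rfl, -⟩ <;> exact hd ‹_›
  have hxa := hsnd x x.2 hx1
  have hfst : f x + b ≠ 0 := by
    rcases hab with ⟨-, rfl⟩ | ⟨-, rfl⟩
    · exact hd fun e => x.2 (hinj (e.trans hf0.symm))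
    · exact hd fun e => hx1 (hinj (e.trans hf1.symm))
  obtain ⟨y, ⟨hyx, hy⟩, hyu⟩ := hsec x ((f x + b) / (x + a)) (div_ne_zero hfst hxa)
  rw [div_mul_eq_mul_div, eq_div_iff hxa] at hy
  have hyline : (f y + b) * (x + a) = (f x + b) * (y + a) := by
    linear_combination hy + (b * x - f x * a) * h2
  have hy0 : y ≠ 0 := by
    rintro rfl
    rw [hf0] at hyline
    rcases hab with ⟨rfl, rfl⟩ | ⟨rfl, rfl⟩
    · exact hfst (by linear_combination -hyline)
    · exact hxa (by linear_combination hyline)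
  have hy1 : y ≠ 1 := by
    rintro rfl
    rw [hf1] at hyline
    rcases hab with ⟨rfl, rfl⟩ | ⟨rfl, rfl⟩
    · exact hxa (by linear_combination hyline + f x * h2)
    · exact hfst (by linear_combination -hyline + x * h2)
  lift y to {x : F // x ≠ 0} using hy0
  have hya := hsnd y y.2 hy1
  have hxy : x ≠ y := fun e => hyx (by rw [e])
  have hxy0 : x.1 + y ≠ 0 := hd hyx.symm
  have hxyl : (.inl x : {x : F // x ≠ 0} ⊕ Fin 2) ≠ .inl y := by simpa using hxy
  refine ⟨fun l => if l = .inl x then c * (y + a) / (x + y) else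
    if l = .inl y then c * (x + a) / (x + y) else if l = .inr j then c else 0, ⟨⟨?_, ?_⟩, ?_⟩, ?_⟩
  · refine (dual_iff_of_support hxyl Sum.inl_ne_inr (Sum.inl_ne_inr (b := j)) fun l hl => ?_).2 ?_
    · by_contra! hl'
      simp [hl'] at hl
    simp only [if_true, hxyl.symm, if_false, reduceCtorEq, ha, hb]
    simp only [ovalFst, ovalSnd, Sum.elim_inl]
    refine ⟨?_, ?_, ?_⟩ <;> field_simp
    · linear_combination c * hy + c * (f x * y + b * (x + y)) * h2
    · linear_combination c * (x.1 * y + a * x + a * y) * h2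
    · linear_combination c * (x.1 + y + a) * h2
  · refine Finset.card_eq_three.2 ⟨.inl x, .inl y, .inr j, hxyl, Sum.inl_ne_inr, Sum.inl_ne_inr, ?_⟩
    ext l
    have hα : c * (y + a) / (x + y) ≠ 0 := div_ne_zero (mul_ne_zero hc hya) hxy0
    have hβ : c * (x + a) / (x + y) ≠ 0 := div_ne_zero (mul_ne_zero hc hxa) hxy0
    simp only [Finset.mem_filter, Finset.mem_univ, true_and, Finset.mem_insert,
      Finset.mem_singleton]
    split_ifs with h₁ h₂ h₃
    · exact iff_of_true hα (.inl h₁)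
    · exact iff_of_true hβ (.inr (.inl h₂))
    · exact iff_of_true hc (.inr (.inr h₃))
    · exact iff_of_false (fun h => h rfl) (by tauto)
  · simp [hc, hya, hxy0]
  · rintro v ⟨⟨hv, hwt⟩, hvx, hvj⟩
    obtain ⟨x', y', j', hxy', -, -, h⟩ := exists_support_of_dual hinj hf1 hsec hline hv hwt
    obtain rfl : j = j' := by simpa using (h (.inr j)).1 (hvj ▸ hc)
    obtain ⟨z, hxz, hz⟩ : ∃ z, x ≠ z ∧ ∀ l, v l ≠ 0 ↔ l = .inl x ∨ l = .inl z ∨ l = .inr j := by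
      rcases (h _).1 hvx with e | e | e
      · obtain rfl := Sum.inl_injective e
        exact ⟨y', hxy', h⟩
      · obtain rfl := Sum.inl_injective e
        exact ⟨x', hxy'.symm, fun l => by rw [h]; tauto⟩
      · cases e
    obtain ⟨e₁, e₂, e₃⟩ := (dual_iff_of_support (by simpa using hxz) Sum.inl_ne_inr
      Sum.inl_ne_inr fun l => (hz l).1).1 hv
    simp only [hvj, ha, hb] at e₁ e₂ e₃
    simp only [ovalFst, ovalSnd, Sum.elim_inl] at e₁ e₂
    obtain rfl : z = y := by
      refine Subtype.ext (hyu z ⟨fun e => hxz (Subtype.ext e.symm), ?_⟩)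
      rw [div_mul_eq_mul_div, eq_div_iff hxa]
      have := slope_eq_of_combination_eq_zero hc e₁ e₂ e₃
      linear_combination -this
    funext l
    split_ifs with hl₁ hl₂ hl₃
    · subst hl₁
      rw [eq_div_iff hxy0]
      linear_combination e₂ - z * e₃ + (v (.inl x) * z - c * a) * h2
    · subst hl₂
      rw [eq_div_iff hxy0]
      linear_combination e₂ - x * e₃ + (v (.inl z) * x - c * a) * h2
    · rw [hl₃, hvj]
    · by_contra hl
      exact ((hz l).1 hl).elim hl₁ (Or.elim · hl₂ hl₃)

end OvalCode

/-- **Theorem.**  Let `m ≥ 3` be odd, `q = 2^m`, `F = GF(q)` and let `f` be an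
oval polynomial over `F` with `f(x²) = f(x)²` for all `x`.  Then the number of
codewords of Hamming weight `3` in the dual code `C_f^⊥` is exactly
`(q-1)(q-2)`. -/
theorem stmt_10 (m : ℕ) (hm : 3 ≤ m) (hmodd : Odd m)
    (F : Type) [Field F] [Fintype F] [DecidableEq F] (hcard : Fintype.card F = 2 ^ m)
    (f : F → F)
    (hbij : Function.Bijective f) (hf0 : f 0 = 0) (hf1 : f 1 = 1)
    (hoval : ∀ a : F, Function.Bijective fun x : F => (f (x + a) + f a) * x ^ (2 ^ m - 2))
    (hfrob : ∀ x : F, f (x ^ 2) = f x ^ 2) :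
    Nat.card {v : {x : F // x ≠ 0} ⊕ Fin 2 → F //
        (∀ p : F × F × F, ∑ i, v i * Cword f p i = 0) ∧ wt v = 3}
      = (2 ^ m - 1) * (2 ^ m - 2) := by
  classical
  have := charP_two_of_card hcard
  have hsec (x s : F) (hs : s ≠ 0) := existsUnique_secant (by omega) hcard hoval x hs
  have hline := add_self_ne_one_of_frobenius hmodd hcard hf0 hf1 hsec hfrob
  rw [Nat.card_eq_fintype_card, Fintype.card_subtype]
  set S := Finset.univ.filter fun v : {x : F // x ≠ 0} ⊕ Fin 2 → F =>
    (∀ p : F × F × F, ∑ i, v i * Cword f p i = 0) ∧ wt v = 3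
  let T : Finset (Fin 2 × {x : F // x ≠ 0} × F) :=
    Finset.univ ×ˢ (Finset.univ.erase ⟨1, one_ne_zero⟩ ×ˢ Finset.univ.erase 0)
  have hT : T.card = 2 * ((2 ^ m - 2) * (2 ^ m - 1)) := by
    have hF : Fintype.card {x : F // x ≠ 0} = 2 ^ m - 1 := by
      rw [Fintype.card_subtype_compl, Fintype.card_subtype_eq, hcard]
    rw [Finset.card_product, Finset.card_product, Finset.card_erase_of_mem (Finset.mem_univ _),
      Finset.card_erase_of_mem (Finset.mem_univ _), Finset.card_univ, Finset.card_univ,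
      Finset.card_univ, hF, hcard, Fintype.card_fin, Nat.sub_sub]
  have hcount : S.card * 2 = T.card * 1 := by
    refine Finset.card_mul_eq_card_mul
      (fun v p => v (.inl p.2.1) ≠ 0 ∧ v (.inr p.1) = p.2.2) (fun v hv => ?_) (fun p hp => ?_)
    · obtain ⟨hv, hwt⟩ := (Finset.mem_filter.1 hv).2
      obtain ⟨x, y, j, hxy, hx, hy, h⟩ := exists_support_of_dual hbij.1 hf1 hsec hline hv hwt
      refine Finset.card_eq_two.2 ⟨(j, x, v (.inr j)), (j, y, v (.inr j)), by simp [hxy], ?_⟩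
      ext ⟨k, z, c⟩
      have hk := h (.inr k)
      have hz := h (.inl z)
      simp only [reduceCtorEq, false_or, or_false, Sum.inr.injEq, Sum.inl.injEq] at hk hz
      simp only [Finset.mem_bipartiteAbove, T, Finset.mem_product, Finset.mem_univ, true_and,
        Finset.mem_erase, and_true, Finset.mem_insert, Finset.mem_singleton, Prod.mk.injEq, hz]
      constructor
      · rintro ⟨⟨-, hc⟩, hzxy, rfl⟩
        obtain rfl := hk.1 hc
        exact hzxy.imp (⟨rfl, ·, rfl⟩) (⟨rfl, ·, rfl⟩)
      · rintro (⟨rfl, rfl, rfl⟩ | ⟨rfl, rfl, rfl⟩)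
        · exact ⟨⟨fun e => hx (congrArg Subtype.val e), hk.2 rfl⟩, .inl rfl, rfl⟩
        · exact ⟨⟨fun e => hy (congrArg Subtype.val e), hk.2 rfl⟩, .inr rfl, rfl⟩
    · obtain ⟨j, x, c⟩ := p
      simp only [T, Finset.mem_product, Finset.mem_univ, true_and, Finset.mem_erase,
        and_true] at hp
      obtain ⟨v, hv, hvu⟩ := existsUnique_dual hbij.1 hf0 hf1 hsec hline j
        (fun e => hp.1 (Subtype.ext e)) hp.2
      refine Finset.card_eq_one.2 ⟨v, Finset.ext fun w => ?_⟩
      rw [Finset.mem_bipartiteBelow, Finset.mem_singleton, Finset.mem_filter_univ]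
      exact ⟨hvu w, fun e => e ▸ hv⟩
  rw [hT] at hcount
  linarith [mul_comm (2 ^ m - 1) (2 ^ m - 2)]
end

section
/- Let m ≥ 3 be odd, q = 2^m, F = GF(q), and let f : F → F be an oval polynomial such that f(x^2) = f(x)^2 for all x ∈ F. Then the number of 2-element subsets {x, y} of F \ {0} such that f(x)·(y+1) + f(y)·(x+1) = 0 is exactly (q-2)/2. -/
/-- For a hyperoval given by an o-polynomial `f`, every line joining `(1, 0)` to an affine point
`(x, f x)` with `x ≠ 0, 1` meets the graph of `f` in exactly one further point. -/
lemma existsUnique_secant_through_one_zero {F : Type*} [Field F] [Fintype F] [CharP F 2]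
    (f : F → F) (hf : Function.Injective f) (hf0 : f 0 = 0)
    (hoval : ∀ a : F, Function.Bijective fun x : F =>
      (f (x + a) + f a) * x ^ (Fintype.card F - 2))
    {x : F} (hx0 : x ≠ 0) (hx1 : x ≠ 1) :
    ∃! y : F, y ≠ x ∧ f x * (y + 1) + f y * (x + 1) = 0 := by
  have h2 : (2 : F) = 0 := CharTwo.two_eq_zero
  have hfx : f x ≠ 0 := fun h => hx0 (hf (h.trans hf0.symm))
  have hx1' : x + 1 ≠ 0 := fun h => hx1 (CharTwo.add_eq_zero.mp h)
  have hpow : ∀ t : F, t ≠ 0 → t ^ (Fintype.card F - 2) = t⁻¹ := by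
    intro t ht
    apply eq_inv_of_mul_eq_one_left
    have hc : 1 < Fintype.card F := Fintype.one_lt_card
    rw [← pow_succ, show Fintype.card F - 2 + 1 = Fintype.card F - 1 by omega]
    exact FiniteField.pow_card_sub_one_eq_one t ht
  have key : ∀ t : F, t ≠ 0 →
      ((f (t + x) + f x) * t ^ (Fintype.card F - 2) = f x / (x + 1) ↔
        f x * (t + x + 1) + f (t + x) * (x + 1) = 0) := by
    intro t ht
    rw [hpow t ht, ← div_eq_mul_inv, div_eq_div_iff ht hx1']
    constructor <;> intro h
    · linear_combination h + f x * t * h2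
    · linear_combination h - f x * t * h2
  obtain ⟨t, ht, huniq⟩ := (hoval x).existsUnique (f x / (x + 1))
  have ht0 : t ≠ 0 := by
    rintro rfl
    simp only [zero_add, CharTwo.add_self_eq_zero, zero_mul] at ht
    exact div_ne_zero hfx hx1' ht.symm
  refine ⟨t + x, ⟨by simpa using ht0, (key t ht0).mp ht⟩, ?_⟩
  rintro y ⟨hyx, hy⟩
  have hyx' : y + x ≠ 0 := fun h => hyx (CharTwo.add_eq_zero.mp h)
  have hcancel : y + x + x = y := by linear_combination x * h2
  have := huniq (y + x) ((key _ hyx').mpr (by rw [hcancel]; exact hy))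
  rw [← this, hcancel]

/-- If every element of `T` has exactly one partner for a symmetric relation `R`, and related
distinct elements of `P` lie in `T`, then `T` is split into pairs of related elements. -/
lemma two_mul_card_pairs_eq_card {α : Type*} [Fintype α] [DecidableEq α] (R : α → α → Prop)
    (hR : ∀ x y, R x y → R y x) (P : α → Prop) (T : Finset α)
    (hT : ∀ x, P x → ∀ y, P y → x ≠ y → R x y → x ∈ T)
    (hP : ∀ x ∈ T, P x)
    (hex : ∀ x ∈ T, ∃ y, P y ∧ x ≠ y ∧ R x y)
    (huniq : ∀ x ∈ T, ∀ y z, x ≠ y → R x y → x ≠ z → R x z → y = z) :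
    2 * Nat.card {s : Finset α // s.card = 2 ∧ (∀ x ∈ s, P x) ∧
        ∃ x ∈ s, ∃ y ∈ s, x ≠ y ∧ R x y} = T.card := by
  classical
  set S : Finset (Finset α) := Finset.univ.filter fun s => s.card = 2 ∧ (∀ x ∈ s, P x) ∧
        ∃ x ∈ s, ∃ y ∈ s, x ≠ y ∧ R x y with hS
  have hmem : ∀ s ∈ S, ∀ z ∈ s, z ∈ T ∧ ∃ w, z ≠ w ∧ R z w ∧ s = {z, w} := by
    intro s hs z hz
    obtain ⟨hc, hp, x, hx, y, hy, hxy, hr⟩ := (Finset.mem_filter.mp hs).2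
    have hsxy : s = {x, y} := (Finset.eq_of_subset_of_card_le
      (by simp [Finset.insert_subset_iff, hx, hy]) (by rw [hc, Finset.card_pair hxy])).symm
    rw [hsxy, Finset.mem_insert, Finset.mem_singleton] at hz
    rcases hz with rfl | rfl
    · exact ⟨hT _ (hp _ hx) _ (hp _ hy) hxy hr, y, hxy, hr, hsxy⟩
    · exact ⟨hT _ (hp _ hy) _ (hp _ hx) hxy.symm (hR _ _ hr), x, hxy.symm, hR _ _ hr,
        by rw [hsxy, Finset.pair_comm]⟩
  have hunion : S.biUnion id = T := by
    ext z
    simp only [Finset.mem_biUnion, id]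
    constructor
    · rintro ⟨s, hs, hz⟩
      exact (hmem s hs z hz).1
    · intro hz
      obtain ⟨w, hw, hzw, hr⟩ := hex z hz
      refine ⟨{z, w}, Finset.mem_filter.mpr ⟨Finset.mem_univ _, Finset.card_pair hzw, ?_,
        z, by simp, w, by simp, hzw, hr⟩, by simp⟩
      simp [hP z hz, hw]
  have hdisj : (S : Set (Finset α)).PairwiseDisjoint id := by
    intro s hs t ht hst
    refine Finset.disjoint_left.mpr fun z hzs hzt => hst ?_
    obtain ⟨hzT, w, hzw, hr, rfl⟩ := hmem s hs z hzs
    obtain ⟨-, w', hzw', hr', rfl⟩ := hmem t ht z hzt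
    rw [huniq z hzT w w' hzw hr hzw' hr']
  rw [Nat.card_eq_fintype_card, Fintype.card_subtype, ← hunion, Finset.card_biUnion hdisj,
    Finset.sum_const_nat (m := 2) fun s hs => (Finset.mem_filter.mp hs).2.1, mul_comm]


/-- **Theorem.**  Let `m ≥ 3` be odd, `q = 2^m`, `F = GF(q)` and let `f` be an
oval polynomial over `F` with `f(x²) = f(x)²` for all `x`.  Then the number of
2-element subsets `{x, y}` of `F \ {0}` with `f(x)·(y+1) + f(y)·(x+1) = 0`
is exactly `(q-2)/2`. -/
theorem stmt_14 (m : ℕ) (hm : 3 ≤ m) (hmodd : Odd m)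
    (F : Type) [Field F] [Fintype F] [DecidableEq F] (hcard : Fintype.card F = 2 ^ m)
    (f : F → F)
    (hbij : Function.Bijective f) (hf0 : f 0 = 0) (hf1 : f 1 = 1)
    (hoval : ∀ a : F, Function.Bijective fun x : F => (f (x + a) + f a) * x ^ (2 ^ m - 2))
    (hfrob : ∀ x : F, f (x ^ 2) = f x ^ 2) :
    2 * Nat.card {s : Finset F // s.card = 2 ∧ (∀ x ∈ s, x ≠ 0) ∧
        ∃ x ∈ s, ∃ y ∈ s, x ≠ y ∧ f x * (y + 1) + f y * (x + 1) = 0}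
      = 2 ^ m - 2 := by
  have hchar : CharP F 2 :=
    (CharP.charP_iff_prime_eq_zero Nat.prime_two).mpr <| by
      have h := FiniteField.cast_card_eq_zero F
      rw [hcard, Nat.cast_pow] at h
      exact pow_eq_zero_iff (by omega) |>.mp h
  rw [← hcard] at hoval
  have hsec := fun {x : F} => existsUnique_secant_through_one_zero (x := x) f hbij.1 hf0 hoval
  have hone : ∀ y, f 1 * (y + 1) + f y * (1 + 1) = 0 → y = 1 := by
    intro y h
    rw [hf1, CharTwo.add_self_eq_zero, mul_zero, add_zero, one_mul] at h
    exact CharTwo.add_eq_zero.mp h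
  rw [two_mul_card_pairs_eq_card (fun x y : F => f x * (y + 1) + f y * (x + 1) = 0)
    (fun x y h => by rw [add_comm]; exact h) (fun x => x ≠ 0) ({0, 1}ᶜ : Finset F),
    Finset.card_compl, Finset.card_pair zero_ne_one, hcard]
  · intro x hx y _ hxy h
    simp only [Finset.mem_compl, Finset.mem_insert, Finset.mem_singleton, not_or]
    refine ⟨hx, ?_⟩
    rintro rfl
    exact hxy (hone y h).symm
  all_goals
    intro x hxT
    simp only [Finset.mem_compl, Finset.mem_insert, Finset.mem_singleton, not_or] at hxT
    obtain ⟨hx0, hx1⟩ := hxT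
  · exact hx0
  · obtain ⟨y, ⟨hyx, hy⟩, -⟩ := hsec hx0 hx1
    refine ⟨y, ?_, hyx.symm, hy⟩
    rintro rfl
    rw [hf0, zero_add, mul_one, zero_mul, add_zero] at hy
    exact hx0 (hbij.1 (hy.trans hf0.symm))
  · intro y z hxy hy hxz hz
    exact (hsec hx0 hx1).unique ⟨hxy.symm, hy⟩ ⟨hxz.symm, hz⟩
end
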